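/- Let S be a stably locally compact formal topology. The formal topology map ε_P : Patch(S) → S defined by 𝔄 ε_P a iff 𝔄 ◁_P {r(a)} is a perfect map, and it is a monomorphism in the category of formal topologies and formal topology maps. -/

import Mathlib

noncomputable section
open Classical

universe u v

namespace FTP

/-! ### Basic covers -/

/-- `U ◁ V` : every element of `U` is covered by `V`. -/
def covS {S : Type*} (cov : S → Set S → Prop) (U V : Set S) : Prop :=
  ∀ a ∈ U, cov a V

/-- A basic cover: reflexivity and transitivity. -/
def IsBasicCover {S : Type*} (cov : S → Set S → Prop) : Prop :=
  (∀ (a : S) (U : Set S), a ∈ U → cov a U) ∧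
  (∀ (a : S) (U V : Set S), cov a U → covS cov U V → cov a V)

/-- the way-below relation `a ≪ b`. -/
def wb {S : Type*} (cov : S → Set S → Prop) (a b : S) : Prop :=
  ∀ U : Set S, cov b U → ∃ U₀ : Finset S, ↑U₀ ⊆ U ∧ cov a ↑U₀

/-- the way-below relation between subsets `U ≪ V`. -/
def wbS {S : Type*} (cov : S → Set S → Prop) (U V : Set S) : Prop :=
  ∀ W : Set S, covS cov V W → ∃ W₀ : Finset S, ↑W₀ ⊆ W ∧ covS cov U ↑W₀

/-- A continuous basic cover, with the witnessing function `w`. -/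
def IsContinuous {S : Type*} (cov : S → Set S → Prop) (w : S → Set S) : Prop :=
  (∀ a : S, ∀ b ∈ w a, wb cov b a) ∧ (∀ a : S, cov a (w a))

/-- splitting subsets. -/
def Splitting {S : Type*} (cov : S → Set S → Prop) (V : Set S) : Prop :=
  ∀ (a : S) (U : Set S), a ∈ V → cov a U → (V ∩ U).Nonempty

/-- located subsets. -/
def Located {S : Type*} (cov : S → Set S → Prop) (V : Set S) : Prop :=
  Splitting cov V ∧ ∀ a b : S, wb cov a b → a ∉ V ∨ b ∈ V

/-- inverse image of a relation. -/
def rinv {α β : Type*} (r : α → β → Prop) (U : Set β) : Set α :=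
  {x | ∃ a ∈ U, r x a}

/-- basic cover maps. -/
def IsBCM {α β : Type*} (cov : α → Set α → Prop) (cov' : β → Set β → Prop)
    (r : α → β → Prop) : Prop :=
  ∀ (a : β) (U : Set β), cov' a U → covS cov (rinv r {a}) (rinv r U)

/-- perfect maps. -/
def IsPerfect {α β : Type*} (cov : α → Set α → Prop) (cov' : β → Set β → Prop)
    (r : α → β → Prop) : Prop :=
  ∀ a b : β, wb cov' a b → wbS cov (rinv r {a}) (rinv r {b})

/-- the terminal basic cover `1 = ({∗}, ∈)`. -/
def unitCov : Unit → Set Unit → Prop := fun x U => x ∈ U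

/-! ### Formal topologies -/

/-- `U ↓ V` with respect to a preorder `le`. -/
def down {S : Type*} (le : S → S → Prop) (U V : Set S) : Set S :=
  {c | ∃ a ∈ U, ∃ b ∈ V, le c a ∧ le c b}

/-- A formal topology: a basic cover together with a compatible preorder. -/
def IsFormalTopology {S : Type*} (cov : S → Set S → Prop) (le : S → S → Prop) : Prop :=
  IsBasicCover cov ∧ Reflexive le ∧ Transitive le ∧
  (∀ a b : S, le a b → cov a {b}) ∧
  (∀ (a : S) (U V : Set S), cov a U → cov a V → cov a (down le U V))

/-- formal topology maps. -/
def IsFTM {α β : Type*} (cov : α → Set α → Prop) (le : α → α → Prop)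
    (cov' : β → Set β → Prop) (le' : β → β → Prop) (r : α → β → Prop) : Prop :=
  IsBCM cov cov' r ∧
  covS cov Set.univ (rinv r Set.univ) ∧
  ∀ a b : β, covS cov (down le (rinv r {a}) (rinv r {b})) (rinv r (down le' {a} {b}))

/-- the order on maps. -/
def MapLE {α β : Type*} (cov : α → Set α → Prop) (r s : α → β → Prop) : Prop :=
  ∀ a : β, covS cov (rinv r {a}) (rinv s {a})

/-- equality of maps. -/
def MapEq {α β : Type*} (cov : α → Set α → Prop) (r s : α → β → Prop) : Prop :=
  MapLE cov r s ∧ MapLE cov s r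

/-- composition of relational maps (`comp s r = s ∘ r`). -/
def comp {α β γ : Type*} (s : β → γ → Prop) (r : α → β → Prop) : α → γ → Prop :=
  fun x c => ∃ b, r x b ∧ s b c

/-- `b* = {c | c ↓ b ◁ ∅}`. -/
def star {S : Type*} (cov : S → Set S → Prop) (le : S → S → Prop) (b : S) : Set S :=
  {c | covS cov (down le {c} {b}) ∅}

/-- `b ⋘ a` iff `S ◁ b* ∪ {a}`. -/
def wc {S : Type*} (cov : S → Set S → Prop) (le : S → S → Prop) (b a : S) : Prop :=
  covS cov Set.univ (star cov le b ∪ {a})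

/-- regular formal topologies. -/
def Regular {S : Type*} (cov : S → Set S → Prop) (le : S → S → Prop) : Prop :=
  ∀ a : S, cov a {b | wc cov le b a}

/-- compactness: `S ≪ S`. -/
def Compact {S : Type*} (cov : S → Set S → Prop) : Prop :=
  wbS cov Set.univ Set.univ

/-- stability: `a ≪ a'` and `b ≪ b'` imply `a↓b ≪ a'↓b'`. -/
def Stable {S : Type*} (cov : S → Set S → Prop) (le : S → S → Prop) : Prop :=
  ∀ a a' b b' : S, wb cov a a' → wb cov b b' →
    wbS cov (down le {a} {b}) (down le {a'} {b'})

/-- isomorphism of formal topologies. -/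
def IsIso {α β : Type*} (cov : α → Set α → Prop) (le : α → α → Prop)
    (cov' : β → Set β → Prop) (le' : β → β → Prop) : Prop :=
  ∃ (r : α → β → Prop) (s : β → α → Prop),
    IsFTM cov le cov' le' r ∧ IsFTM cov' le' cov le s ∧
    MapEq cov (comp s r) (fun a b => a = b) ∧
    MapEq cov' (comp r s) (fun a b => a = b)

/-! ### Geometric theories and the covers they present -/

/-- the preorder `A ≤ B ↔ B ⊆ A` on finite sets of generators. -/
def supord {P : Type*} : Finset P → Finset P → Prop := fun A B => B ⊆ A

/-- The cover on `Finset P` inductively generated by a geometric theory `T`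
(an axiom `T A 𝒞` means `⋀A ⊢ ⋁_{B ∈ 𝒞} ⋀B`). -/
inductive GCov {P : Type*} (T : Finset P → Set (Finset P) → Prop) :
    Finset P → Set (Finset P) → Prop where
  | refl {A : Finset P} {𝒰 : Set (Finset P)} : A ∈ 𝒰 → GCov T A 𝒰
  | le {A B : Finset P} {𝒰 : Set (Finset P)} : B ⊆ A → GCov T B 𝒰 → GCov T A 𝒰
  | ax {A : Finset P} {𝒞 𝒰 : Set (Finset P)} (C : Finset P) :
      T A 𝒞 → (∀ B ∈ 𝒞, GCov T (C ∪ B) 𝒰) → GCov T (C ∪ A) 𝒰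

theorem GCov_trans {P : Type*} {T : Finset P → Set (Finset P) → Prop}
    {A : Finset P} {𝒰 𝒱 : Set (Finset P)}
    (h : GCov T A 𝒰) (h' : ∀ B ∈ 𝒰, GCov T B 𝒱) : GCov T A 𝒱 := by
  induction h with
  | refl hA => exact h' _ hA
  | le hBA _ ih => exact GCov.le hBA (ih h')
  | ax C hT _ ih => exact GCov.ax C hT (fun B hB => ih B hB h')

theorem GCov_isBasicCover {P : Type*} (T : Finset P → Set (Finset P) → Prop) :
    IsBasicCover (GCov T) :=
  ⟨fun _ _ h => GCov.refl h, fun _ _ _ h h' => GCov_trans h h'⟩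

/-! ### The patch, Lawson and lower powerlocale theories -/

/-- generators of the patch/Lawson theories : `r a` and `l A`. -/
inductive PatchGen (S : Type u) : Type u where
  | r : S → PatchGen S
  | l : Finset S → PatchGen S

/-- The geometric theory `T_P` presenting the patch of a stably locally compact
formal topology. -/
inductive PatchThy {S : Type*} (cov : S → Set S → Prop) (le : S → S → Prop) :
    Finset (PatchGen S) → Set (Finset (PatchGen S)) → Prop where
  | R1 : PatchThy cov le ∅ {B | ∃ a : S, B = {PatchGen.r a}}
  | R2 (a b : S) :
      PatchThy cov le {PatchGen.r a, PatchGen.r b}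
        {B | ∃ c ∈ down le {a} {b}, B = {PatchGen.r c}}
  | R3 (a : S) (A : Finset S) :
      cov a ↑A → PatchThy cov le {PatchGen.r a} {B | ∃ b ∈ A, B = {PatchGen.r b}}
  | R4 (a : S) :
      PatchThy cov le {PatchGen.r a} {B | ∃ b : S, wb cov b a ∧ B = {PatchGen.r b}}
  | L1 : PatchThy cov le ∅ {({PatchGen.l ∅} : Finset (PatchGen S))}
  | L2 (A B : Finset S) :
      covS cov ↑A ↑B →
      PatchThy cov le {PatchGen.l B} {({PatchGen.l A} : Finset (PatchGen S))}
  | L3 (A B : Finset S) :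
      PatchThy cov le {PatchGen.l A, PatchGen.l B}
        {D | ∃ C : Finset S, wbS cov ↑A ↑C ∧ wbS cov ↑B ↑C ∧ D = {PatchGen.l C}}
  | Loc (a b : S) :
      wb cov a b →
      PatchThy cov le ∅
        {({PatchGen.l {a}} : Finset (PatchGen S)), ({PatchGen.r b} : Finset (PatchGen S))}
  | D (a : S) :
      PatchThy cov le {PatchGen.l {a}, PatchGen.r a} (∅ : Set (Finset (PatchGen S)))

/-- the cover of `Patch(S)`. -/
def patchCov {S : Type*} (cov : S → Set S → Prop) (le : S → S → Prop) :
    Finset (PatchGen S) → Set (Finset (PatchGen S)) → Prop :=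
  GCov (PatchThy cov le)

/-- the counit `ε_P : Patch(S) → S`. -/
def epsP {S : Type*} (cov : S → Set S → Prop) (le : S → S → Prop) :
    Finset (PatchGen S) → S → Prop :=
  fun 𝔄 a => patchCov cov le 𝔄 {({PatchGen.r a} : Finset (PatchGen S))}

/-- The geometric theory `T_L` presenting the Lawson topology of a continuous
basic cover (the axioms of `T_P` without (R1), (R2)). -/
inductive LawsonThy {S : Type*} (cov : S → Set S → Prop) :
    Finset (PatchGen S) → Set (Finset (PatchGen S)) → Prop where
  | R3 (a : S) (A : Finset S) :
      cov a ↑A → LawsonThy cov {PatchGen.r a} {B | ∃ b ∈ A, B = {PatchGen.r b}}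
  | R4 (a : S) :
      LawsonThy cov {PatchGen.r a} {B | ∃ b : S, wb cov b a ∧ B = {PatchGen.r b}}
  | L1 : LawsonThy cov ∅ {({PatchGen.l ∅} : Finset (PatchGen S))}
  | L2 (A B : Finset S) :
      covS cov ↑A ↑B →
      LawsonThy cov {PatchGen.l B} {({PatchGen.l A} : Finset (PatchGen S))}
  | L3 (A B : Finset S) :
      LawsonThy cov {PatchGen.l A, PatchGen.l B}
        {D | ∃ C : Finset S, wbS cov ↑A ↑C ∧ wbS cov ↑B ↑C ∧ D = {PatchGen.l C}}
  | Loc (a b : S) :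
      wb cov a b →
      LawsonThy cov ∅
        {({PatchGen.l {a}} : Finset (PatchGen S)), ({PatchGen.r b} : Finset (PatchGen S))}
  | D (a : S) :
      LawsonThy cov {PatchGen.l {a}, PatchGen.r a} (∅ : Set (Finset (PatchGen S)))

/-- the cover of the Lawson topology `L(S)`. -/
def lawsonCov {S : Type*} (cov : S → Set S → Prop) :
    Finset (PatchGen S) → Set (Finset (PatchGen S)) → Prop :=
  GCov (LawsonThy cov)

/-- the counit `ε_L : L(S) → S`. -/
def epsL {S : Type*} (cov : S → Set S → Prop) : Finset (PatchGen S) → S → Prop :=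
  fun 𝔄 a => lawsonCov cov 𝔄 {({PatchGen.r a} : Finset (PatchGen S))}

/-- The theory presenting the lower powerlocale of a continuous basic cover:
generators `a ∈ S`, axioms (R3) and (R4). -/
inductive LowerThy {S : Type*} (cov : S → Set S → Prop) :
    Finset S → Set (Finset S) → Prop where
  | R3 (a : S) (A : Finset S) :
      cov a ↑A → LowerThy cov {a} {B | ∃ b ∈ A, B = ({b} : Finset S)}
  | R4 (a : S) :
      LowerThy cov {a} {B | ∃ b : S, wb cov b a ∧ B = ({b} : Finset S)}

/-- the cover of the lower powerlocale `Lower(S)`. -/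
def lowerCov {S : Type*} (cov : S → Set S → Prop) :
    Finset S → Set (Finset S) → Prop :=
  GCov (LowerThy cov)

/-- the counit `σ_L : Lower(S) → S`. -/
def sigmaL {S : Type*} (cov : S → Set S → Prop) : Finset S → S → Prop :=
  fun A a => lowerCov cov A ({({a} : Finset S)} : Set (Finset S))

/-! ### de Groot duals -/

/-- `↟A = {B ∈ Fin S | A ≪ B}`. -/
def upF {S : Type*} (cov : S → Set S → Prop) (A : Finset S) : Set (Finset S) :=
  {B | wbS cov ↑A ↑B}

/-- the finite join `⋁^F {↟A | A ∈ 𝒜}` of Scott open filters. -/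
def finJoin {S : Type*} (cov : S → Set S → Prop) (le : S → S → Prop)
    (𝒜 : Finset (Finset S)) : Set (Finset S) :=
  if 𝒜 = ∅ then {B | covS cov Set.univ ↑B}
  else {B | ∃ g : Finset S → Finset S,
    (∀ A ∈ 𝒜, wbS cov ↑A ↑(g A)) ∧
    wbS cov {c | ∀ A ∈ 𝒜, ∃ b ∈ g A, le c b} ↑B}

/-- The cover `◁^D` of the de Groot dual `S^D`, inductively generated on
`(Fin S, ⊇)` by the axioms (D3) `A ◁ ↟A` and (D4). -/
inductive DCov {S : Type*} (cov : S → Set S → Prop) (le : S → S → Prop) :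
    Finset S → Set (Finset S) → Prop where
  | refl {A : Finset S} {𝒰 : Set (Finset S)} : A ∈ 𝒰 → DCov cov le A 𝒰
  | le {A B : Finset S} {𝒰 : Set (Finset S)} :
      B ⊆ A → DCov cov le B 𝒰 → DCov cov le A 𝒰
  | d3 {A A' : Finset S} {𝒰 : Set (Finset S)} :
      A ⊆ A' →
      (∀ C : Finset S, A' ⊆ C → (∃ B : Finset S, wbS cov ↑A ↑B ∧ B ⊆ C) →
        DCov cov le C 𝒰) →
      DCov cov le A' 𝒰
  | d4 {A A' : Finset S} {𝒜 : Finset (Finset S)} {𝒰 : Set (Finset S)} :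
      A ⊆ A' → upF cov A ⊆ finJoin cov le 𝒜 →
      (∀ C : Finset S, A' ⊆ C → (∃ B ∈ 𝒜, B ⊆ C) → DCov cov le C 𝒰) →
      DCov cov le A' 𝒰

/-- the cover of the Scott topology `Σ(S)` on `(Fin S, ⊇)`. -/
def scottCov {S : Type*} (cov : S → Set S → Prop) :
    Finset S → Set (Finset S) → Prop :=
  fun A 𝒰 => upF cov A ⊆ ⋃ B ∈ 𝒰, upF cov B

/-- a filter (with respect to `◁`) of basic opens, given by a set of finite subsets. -/
def IsCovFilter {S : Type*} (cov : S → Set S → Prop) (le : S → S → Prop)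
    (𝒱 : Set (Finset S)) : Prop :=
  𝒱.Nonempty ∧
  (∀ A ∈ 𝒱, ∀ B : Finset S, covS cov ↑A ↑B → B ∈ 𝒱) ∧
  (∀ A ∈ 𝒱, ∀ B ∈ 𝒱, ∃ C ∈ 𝒱, covS cov ↑C (down le ↑A ↑B))

/-- The geometric theory `T^d` presenting the de Groot dual `S^d`:
generators `l A` (identified with `A : Finset S`), axioms (L1)–(L3) and (D4). -/
inductive DGThy {S : Type*} (cov : S → Set S → Prop) (le : S → S → Prop) :
    Finset (Finset S) → Set (Finset (Finset S)) → Prop where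
  | L1 : DGThy cov le ∅ {({(∅ : Finset S)} : Finset (Finset S))}
  | L2 (A B : Finset S) :
      covS cov ↑A ↑B → DGThy cov le {B} {({A} : Finset (Finset S))}
  | L3 (A B : Finset S) :
      DGThy cov le {A, B}
        {D | ∃ C : Finset S, wbS cov ↑A ↑C ∧ wbS cov ↑B ↑C ∧ D = ({C} : Finset (Finset S))}
  | D4 (A : Finset S) (𝒜 : Finset (Finset S)) :
      upF cov A ⊆ finJoin cov le 𝒜 →
      DGThy cov le {A} {D | ∃ B ∈ 𝒜, D = ({B} : Finset (Finset S))}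

/-! ### Spectral formal topologies -/

/-- spectral formal topologies: a compatible meet-semilattice structure on the
base, with every basic element way-below itself. -/
def IsSpectral {S : Type*} (cov : S → Set S → Prop) (le : S → S → Prop)
    (one : S) (meet : S → S → S) : Prop :=
  (∀ a : S, cov a {one}) ∧
  (∀ a b : S, cov (meet a b) (down le {a} {b})) ∧
  (∀ a b : S, ∀ c ∈ down le {a} {b}, cov c {meet a b}) ∧
  (∀ a : S, wb cov a a)

/-! ### Subtopologies -/

/-- the property of being a formal-topology cover compatible with `le`. -/
def IsFTCover {S : Type*} (cov : S → Set S → Prop) (le : S → S → Prop) : Prop :=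
  IsBasicCover cov ∧ (∀ a b : S, le a b → cov a {b}) ∧
  (∀ (a : S) (U V : Set S), cov a U → cov a V → cov a (down le U V))

/-- The meet (in `SubTop(S)`) of a family of subtopology covers: the least
formal-topology cover containing all of them. -/
def covMeet {S : Type*} {ι : Sort*} (le : S → S → Prop)
    (F : ι → (S → Set S → Prop)) : S → Set S → Prop :=
  fun a U => ∀ c : S → Set S → Prop,
    IsFTCover c le → (∀ i : ι, ∀ (a' : S) (U' : Set S), F i a' U' → c a' U') → c a U

/-- the closed subtopology `C_a` determined by `{a}`. -/
def closedCov {S : Type*} (cov : S → Set S → Prop) (a : S) : S → Set S → Prop :=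
  fun c V => cov c ({a} ∪ V)

/-- the open subtopology `S_B` determined by a finite `B`. -/
def openCov {S : Type*} (cov : S → Set S → Prop) (le : S → S → Prop)
    (B : Finset S) : S → Set S → Prop :=
  fun c V => covS cov (down le {c} ↑B) V

/-- `K_A = ⋀_{A ≪ B} S_B`. -/
def KCov {S : Type*} (cov : S → Set S → Prop) (le : S → S → Prop) (A : Finset S) :
    S → Set S → Prop :=
  covMeet le (fun B : {B : Finset S // wbS cov ↑A ↑B} => openCov cov le B.1)

/-- `C_a ∨ K_A` (the join of subtopologies is the intersection of covers). -/
def CKCov {S : Type*} (cov : S → Set S → Prop) (le : S → S → Prop)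
    (a : S) (A : Finset S) : S → Set S → Prop :=
  fun c V => closedCov cov a c V ∧ KCov cov le A c V

/-- perfect subtopologies. -/
def IsPerfectSub {S : Type*} (cov : S → Set S → Prop) (le : S → S → Prop)
    (cov' : S → Set S → Prop) : Prop :=
  IsFTCover cov' le ∧ (∀ (a : S) (U : Set S), cov a U → cov' a U) ∧
  (∀ a b : S, wb cov a b → wb cov' a b)

/-- the order of `PSub(S)`: `(a,A) ≤ (b,B)` iff `C_b ∨ K_B ⊑ C_a ∨ K_A`. -/
def PSubLe {S : Type*} (cov : S → Set S → Prop) (le : S → S → Prop) :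
    S × Finset S → S × Finset S → Prop :=
  fun p q => ∀ (c : S) (V : Set S), CKCov cov le p.1 p.2 c V → CKCov cov le q.1 q.2 c V

/-- the cover of `PSub(S)`: `(a,A) ◁ U` iff `⋀{C_b ∨ K_B | (b,B) ∈ U} ⊑ C_a ∨ K_A`. -/
def covPSub {S : Type*} (cov : S → Set S → Prop) (le : S → S → Prop) :
    S × Finset S → Set (S × Finset S) → Prop :=
  fun p U => ∀ (c : S) (V : Set S), CKCov cov le p.1 p.2 c V →
    covMeet le (fun q : U => CKCov cov le q.1.1 q.1.2) c V

/-- the map `r : PSub(S) → Patch(S)` on generators. -/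
def rGenPS {S : Type*} (cov : S → Set S → Prop) (le : S → S → Prop)
    (p : S × Finset S) : PatchGen S → Prop
  | PatchGen.r b => covPSub cov le p {((b, (∅ : Finset S)) : S × Finset S)}
  | PatchGen.l B => covPSub cov le p {q : S × Finset S | q.2 = B}

/-- the map `r : PSub(S) → Patch(S)`, extended along the presentation. -/
def rPS {S : Type*} (cov : S → Set S → Prop) (le : S → S → Prop) :
    S × Finset S → Finset (PatchGen S) → Prop :=
  fun p 𝔅 => ∀ g ∈ 𝔅, covPSub cov le p (rinv (fun q g' => rGenPS cov le q g') {g})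

/-- the map `s : Patch(S) → PSub(S)`. -/
def sPS {S : Type*} (cov : S → Set S → Prop) (le : S → S → Prop) :
    Finset (PatchGen S) → (S × Finset S) → Prop :=
  fun 𝔄 p => patchCov cov le 𝔄
    ({({PatchGen.r p.1, PatchGen.l p.2} : Finset (PatchGen S))} : Set (Finset (PatchGen S)))

/-! ### Saturated subsets, dcpos and preframes -/

/-- the saturated subsets of a basic cover. -/
abbrev SatSet {α : Type*} (cov : α → Set α → Prop) : Type _ :=
  {U : Set α // ∀ a, cov a U → a ∈ U}

/-- the join of a family of saturated subsets. -/
def satSup {α : Type*} {cov : α → Set α → Prop} (hbc : IsBasicCover cov)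
    (D : Set (SatSet cov)) : SatSet cov :=
  ⟨{a | cov a (⋃ U ∈ D, (U : Set α))}, fun a h => hbc.2 a _ _ h (fun _ hb => hb)⟩

/-- inductively generated basic covers: `BGen Ax` is the cover generated by the
axiom-set with axioms `a ◁ C` for `C ∈ Ax a`. -/
inductive BGen {S : Type*} (Ax : S → Set (Set S)) : S → Set S → Prop where
  | refl {a : S} {U : Set S} : a ∈ U → BGen Ax a U
  | infty {a : S} {U : Set S} (C : Set S) :
      C ∈ Ax a → (∀ b ∈ C, BGen Ax b U) → BGen Ax a U

theorem BGen_trans {S : Type*} {Ax : S → Set (Set S)} {a : S} {U V : Set S}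
    (h : BGen Ax a U) (h' : ∀ b ∈ U, BGen Ax b V) : BGen Ax a V := by
  induction h with
  | refl ha => exact h' _ ha
  | infty C hC _ ih => exact BGen.infty C hC (fun b hb => ih b hb h')

theorem BGen_isBasicCover {S : Type*} (Ax : S → Set (Set S)) :
    IsBasicCover (BGen Ax) :=
  ⟨fun _ _ h => BGen.refl h, fun _ _ _ h h' => BGen_trans h h'⟩

/-- the lower powerlocale theory of an inductively generated basic cover. -/
inductive LowerThyAx {S : Type*} (Ax : S → Set (Set S)) :
    Finset S → Set (Finset S) → Prop where
  | mk (a : S) (C : Set S) :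
      C ∈ Ax a → LowerThyAx Ax {a} {B | ∃ b ∈ C, B = ({b} : Finset S)}

/-- the counit `σ_L : Lower(S) → S` for an inductively generated basic cover. -/
def sigmaLAx {S : Type*} (Ax : S → Set (Set S)) : Finset S → S → Prop :=
  fun A a => GCov (LowerThyAx Ax) A ({({a} : Finset S)} : Set (Finset S))

/-- the top saturated subset of a presented topology. -/
def satTop {P : Type*} (T : Finset P → Set (Finset P) → Prop) : SatSet (GCov T) :=
  ⟨Set.univ, fun _ _ => Set.mem_univ _⟩

/-- binary meets of saturated subsets of a presented topology. -/
def satInfL {P : Type*} (T : Finset P → Set (Finset P) → Prop)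
    (U V : SatSet (GCov T)) : SatSet (GCov T) :=
  ⟨{A | GCov T A (down supord (U : Set (Finset P)) (V : Set (Finset P)))},
   fun _ h => GCov_trans h (fun _ hB => hB)⟩

/-- the suplattice homomorphism `σ_L* : Sat(S) → Sat(Lower(S))`. -/
def sigmaStar {S : Type*} (Ax : S → Set (Set S)) (U : SatSet (BGen Ax)) :
    SatSet (GCov (LowerThyAx Ax)) :=
  ⟨{A : Finset S | GCov (LowerThyAx Ax) A (rinv (sigmaLAx Ax) (U : Set S))},
   fun _ h => GCov_trans h (fun _ hB => hB)⟩

/-- a preframe structure on a partial order: finite meets and directed joins,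
with finite meets distributing over directed joins. -/
structure PreframeStr (X : Type*) [PartialOrder X] where
  top : X
  inf : X → X → X
  dSup : Set X → X
  le_top : ∀ x, x ≤ top
  inf_le_left : ∀ x y, inf x y ≤ x
  inf_le_right : ∀ x y, inf x y ≤ y
  le_inf : ∀ x y z, x ≤ y → x ≤ z → x ≤ inf y z
  le_dSup : ∀ d : Set X, d.Nonempty → DirectedOn (· ≤ ·) d → ∀ x ∈ d, x ≤ dSup d
  dSup_le : ∀ d : Set X, d.Nonempty → DirectedOn (· ≤ ·) d →
    ∀ z, (∀ x ∈ d, x ≤ z) → dSup d ≤ z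
  distrib : ∀ (x : X) (d : Set X), d.Nonempty → DirectedOn (· ≤ ·) d →
    inf x (dSup d) = dSup ((fun y => inf x y) '' d)

/-- dcpo homomorphisms out of `Sat(S)`. -/
def IsDcpoHom {α : Type*} {cov : α → Set α → Prop} (hbc : IsBasicCover cov)
    {X : Type*} [PartialOrder X] (PF : PreframeStr X) (f : SatSet cov → X) : Prop :=
  Monotone f ∧
  ∀ D : Set (SatSet cov), D.Nonempty → DirectedOn (· ≤ ·) D →
    f (satSup hbc D) = PF.dSup (f '' D)

/-- preframe homomorphisms out of the frame of a presented topology. -/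
def IsPreframeHomL {P : Type*} (T : Finset P → Set (Finset P) → Prop)
    {X : Type*} [PartialOrder X] (PF : PreframeStr X)
    (F : SatSet (GCov T) → X) : Prop :=
  Monotone F ∧ F (satTop T) = PF.top ∧
  (∀ U V, F (satInfL T U V) = PF.inf (F U) (F V)) ∧
  ∀ D : Set (SatSet (GCov T)), D.Nonempty → DirectedOn (· ≤ ·) D →
    F (satSup (GCov_isBasicCover T) D) = PF.dSup (F '' D)

/-! ### Located subsets: auxiliary notions -/

/-- the lower part `L_V` associated to a located subset `V`. -/
def LV {S : Type*} (cov : S → Set S → Prop) (V : Set S) : Set S :=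
  {a | ∃ A : Finset S, wbS cov {a} ↑A ∧ (↑A ∩ V : Set S) = ∅}

/-- cuts of a continuous basic cover. -/
def IsCut {S : Type*} (cov : S → Set S → Prop) (L U : Set S) : Prop :=
  (∀ (a : S) (A : Finset S), cov a ↑A → a ∈ U → ((↑A : Set S) ∩ U).Nonempty) ∧
  (∀ a ∈ U, ∃ b : S, wb cov b a ∧ b ∈ U) ∧
  (∀ (a : S) (A : Finset S), cov a ↑A → (↑A : Set S) ⊆ L → a ∈ L) ∧
  (∀ a ∈ L, ∃ A : Finset S, wbS cov {a} ↑A ∧ (↑A : Set S) ⊆ L) ∧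
  (∀ a b : S, wb cov a b → a ∈ L ∨ b ∈ U) ∧
  L ∩ U = ∅

end FTP

namespace FTP

/-! ### Presented covers -/

section Presented

variable {P : Type*} {T : Finset P → Set (Finset P) → Prop}

theorem GCov_mono {A : Finset P} {𝒰 𝒱 : Set (Finset P)} (h : GCov T A 𝒰) (h' : 𝒰 ⊆ 𝒱) :
    GCov T A 𝒱 :=
  GCov_trans h fun _ hB => GCov.refl (h' hB)

theorem GCov_of_axiom {A : Finset P} {𝒞 : Set (Finset P)} (h : T A 𝒞) : GCov T A 𝒞 := by
  have := GCov.ax (𝒰 := 𝒞) ∅ h fun B hB => by simpa using GCov.refl hB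
  simpa using this

theorem GCov_union_left {A : Finset P} {𝒰 : Set (Finset P)} (h : GCov T A 𝒰) (C : Finset P) :
    GCov T (C ∪ A) {D | ∃ B ∈ 𝒰, D = C ∪ B} := by
  induction h with
  | refl hA => exact GCov.refl ⟨_, hA, rfl⟩
  | le hBA _ ih => exact GCov.le (Finset.union_subset_union_right hBA) ih
  | ax C' hT _ ih =>
    rw [← Finset.union_assoc]
    refine GCov.ax _ hT fun B hB => ?_
    rw [Finset.union_assoc]
    exact ih B hB

/-- To cover `A` it suffices to cover the refinements `A ∪ B` along a cover of `A`. -/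
theorem GCov_cut {A : Finset P} {𝒰 𝒱 : Set (Finset P)} (h : GCov T A 𝒰)
    (h' : ∀ B ∈ 𝒰, GCov T (A ∪ B) 𝒱) : GCov T A 𝒱 := by
  have := GCov_union_left h A
  rw [Finset.union_self] at this
  refine GCov_trans this ?_
  rintro _ ⟨B, hB, rfl⟩
  exact h' B hB

theorem GCov_singleton_of_forall {A B : Finset P}
    (h : ∀ g ∈ B, GCov T A {({g} : Finset P)}) : GCov T A {B} := by
  induction B using Finset.induction_on with
  | empty => exact GCov.le (Finset.empty_subset _) (GCov.refl rfl)
  | insert g B _ ih =>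
    refine GCov_cut (ih fun x hx => h x (Finset.mem_insert_of_mem hx)) fun D hD => ?_
    rw [Set.mem_singleton_iff.1 hD]
    refine GCov_cut (GCov.le Finset.subset_union_left (h g (Finset.mem_insert_self _ _)))
      fun D' hD' => ?_
    rw [Set.mem_singleton_iff.1 hD']
    refine GCov.le (B := insert g B) ?_ (GCov.refl rfl)
    intro x hx
    simp only [Finset.mem_insert, Finset.mem_union, Finset.mem_singleton] at hx ⊢
    tauto

end Presented

/-! ### Continuous covers -/

section Continuous

variable {S : Type*} {cov : S → Set S → Prop} {w : S → Set S}

theorem IsBasicCover.mono (hb : IsBasicCover cov) {a : S} {U V : Set S} (h : cov a U)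
    (h' : U ⊆ V) : cov a V :=
  hb.2 a U V h fun x hx => hb.1 x V (h' hx)

theorem covS_of_wbS (hb : IsBasicCover cov) {U V : Set S} (h : wbS cov U V) : covS cov U V := by
  obtain ⟨W, hW, hUW⟩ := h V fun a ha => hb.1 a V ha
  exact fun a ha => hb.mono (hUW a ha) hW

theorem cov_of_wb (hb : IsBasicCover cov) {a b : S} (h : wb cov a b) : cov a {b} := by
  obtain ⟨W, hW, haW⟩ := h {b} (hb.1 b _ rfl)
  exact hb.mono haW hW

theorem wbS_singleton {a b : S} (h : wb cov a b) :
    wbS cov {a} {b} := by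
  intro W hW
  obtain ⟨W₀, h₀, ha⟩ := h W (hW b rfl)
  refine ⟨W₀, h₀, ?_⟩
  rintro _ rfl
  exact ha

theorem wbS_of_covS_left (hb : IsBasicCover cov) {U U' V : Set S} (h : covS cov U U')
    (h' : wbS cov U' V) : wbS cov U V := by
  intro W hW
  obtain ⟨W₀, h₀, hU⟩ := h' W hW
  exact ⟨W₀, h₀, fun a ha => hb.2 a _ _ (h a ha) hU⟩

theorem wbS_of_forall_wb (hb : IsBasicCover cov) {F : Finset S} {V : Set S}
    (h : ∀ f ∈ F, ∃ v ∈ V, wb cov f v) : wbS cov ↑F V := by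
  intro W hW
  have key : ∀ f : S, ∃ W₀ : Finset S, f ∈ F → ↑W₀ ⊆ W ∧ cov f ↑W₀ := by
    intro f
    by_cases hf : f ∈ F
    · obtain ⟨v, hv, hfv⟩ := h f hf
      obtain ⟨W₀, h₀⟩ := hfv W (hW v hv)
      exact ⟨W₀, fun _ => h₀⟩
    · exact ⟨∅, fun h => absurd h hf⟩
  choose g hg using key
  refine ⟨F.biUnion g, ?_, ?_⟩
  · intro x hx
    simp only [Finset.coe_biUnion, Set.mem_iUnion] at hx
    obtain ⟨f, hf, hx⟩ := hx
    exact (hg f hf).1 hx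
  · intro f hf
    exact hb.mono (hg f hf).2
      (Finset.coe_subset.2 (Finset.subset_biUnion_of_mem g (Finset.mem_coe.1 hf)))

theorem exists_finset_wb (hb : IsBasicCover cov) (hw : IsContinuous cov w) {U V V' : Set S}
    (h : wbS cov U V) (hV : covS cov V V') :
    ∃ F : Finset S, covS cov U ↑F ∧ ∀ f ∈ F, ∃ v ∈ V', wb cov f v := by
  obtain ⟨F, hF, hUF⟩ := h {y | ∃ v ∈ V', wb cov y v} fun a ha =>
    hb.2 a _ _ (hV a ha) fun v hv => hb.mono (hw.2 v) fun y hy => ⟨v, hv, hw.1 v y hy⟩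
  exact ⟨F, hUF, fun f hf => hF hf⟩

theorem exists_interpolant (hb : IsBasicCover cov) (hw : IsContinuous cov w) {U V : Set S}
    (h : wbS cov U V) :
    ∃ F : Finset S, wbS cov U ↑F ∧ ∀ f ∈ F, ∃ v ∈ V, wb cov f v := by
  obtain ⟨G, hG, hGV⟩ := exists_finset_wb hb hw (V' := {y | ∃ v ∈ V, wb cov y v}) h
    fun a ha => hb.mono (hw.2 a) fun y hy => ⟨a, ha, hw.1 a y hy⟩
  choose! f hf hgf using hGV
  refine ⟨G.image f, wbS_of_covS_left hb hG (wbS_of_forall_wb hb fun g hg =>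
    ⟨f g, Finset.mem_coe.2 (Finset.mem_image_of_mem f hg), hgf g hg⟩), ?_⟩
  intro y hy
  obtain ⟨g, hg, rfl⟩ := Finset.mem_image.1 hy
  exact hf g hg

end Continuous

/-! ### The patch cover -/

section Patch

variable {S : Type*} {cov : S → Set S → Prop} {le : S → S → Prop} {w : S → Set S}

theorem patchCov_r_finset {a : S} {F : Finset S} (h : cov a ↑F) :
    patchCov cov le {PatchGen.r a} {B | ∃ b ∈ F, B = {PatchGen.r b}} :=
  GCov_of_axiom (PatchThy.R3 a F h)

theorem patchCov_r_of_cov {a b : S} (h : cov a {b}) :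
    patchCov cov le {PatchGen.r a} {({PatchGen.r b} : Finset (PatchGen S))} := by
  refine GCov_mono (patchCov_r_finset (F := {b}) (by simpa using h)) ?_
  rintro _ ⟨c, hc, rfl⟩
  rw [Finset.mem_singleton.1 hc]
  rfl

theorem patchCov_r {a : S} {U : Set S} (h : cov a U) :
    patchCov cov le {PatchGen.r a} {B | ∃ b ∈ U, B = {PatchGen.r b}} := by
  refine GCov_trans (GCov_of_axiom (PatchThy.R4 a)) ?_
  rintro _ ⟨b, hba, rfl⟩
  obtain ⟨F, hF, hbF⟩ := hba U h
  refine GCov_mono (patchCov_r_finset hbF) ?_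
  rintro _ ⟨c, hc, rfl⟩
  exact ⟨c, hF hc, rfl⟩

theorem patchCov_l {A B : Finset S} (h : covS cov ↑A ↑B) :
    patchCov cov le {PatchGen.l B} {({PatchGen.l A} : Finset (PatchGen S))} :=
  GCov_of_axiom (PatchThy.L2 A B h)

theorem patchCov_l_union (hb : IsBasicCover cov) (A B : Finset S) :
    patchCov cov le {PatchGen.l A, PatchGen.l B}
      {({PatchGen.l (A ∪ B)} : Finset (PatchGen S))} := by
  refine GCov_trans (GCov_of_axiom (PatchThy.L3 A B)) ?_
  rintro _ ⟨C, hA, hB, rfl⟩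
  refine patchCov_l ?_
  intro x hx
  rcases Finset.mem_union.1 (Finset.mem_coe.1 hx) with h | h
  · exact covS_of_wbS hb hA x h
  · exact covS_of_wbS hb hB x h

theorem patchCov_l_disjoint_r {a : S} {C : Finset S} (h : cov a ↑C)
    (𝒰 : Set (Finset (PatchGen S))) :
    patchCov cov le {PatchGen.l C, PatchGen.r a} 𝒰 := by
  refine GCov_cut (GCov.le (B := {PatchGen.l C}) (by simp)
    (patchCov_l (A := {a}) (by rintro x hx; simp at hx; rwa [hx]))) ?_
  rintro _ rfl
  refine GCov.le (B := {PatchGen.l {a}, PatchGen.r a}) ?_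
    (GCov_mono (GCov_of_axiom (PatchThy.D a)) (Set.empty_subset _))
  intro x hx
  simp only [Finset.mem_insert, Finset.mem_union, Finset.mem_singleton] at hx ⊢
  tauto

/-- The locatedness axiom for finite sets. -/
theorem patchCov_locatedness (hb : IsBasicCover cov) (hw : IsContinuous cov w) {A B : Finset S}
    (h : wbS cov ↑A ↑B) :
    patchCov cov le ∅ ({({PatchGen.l A} : Finset (PatchGen S))} ∪
      {D | ∃ b ∈ B, D = {PatchGen.r b}}) := by
  obtain ⟨G, hAG, hGB⟩ := exists_finset_wb hb hw h fun a ha => hb.1 a _ ha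
  suffices patchCov cov le ∅ ({({PatchGen.l G} : Finset (PatchGen S))} ∪
      {D | ∃ b ∈ B, D = {PatchGen.r b}}) by
    refine GCov_trans this ?_
    rintro _ (rfl | h)
    · exact GCov_mono (patchCov_l hAG) Set.subset_union_left
    · exact GCov.refl (Or.inr h)
  clear hAG
  induction G using Finset.induction_on with
  | empty => exact GCov_mono (GCov_of_axiom PatchThy.L1) Set.subset_union_left
  | insert g G _ ih =>
    refine GCov_trans (ih fun f hf => hGB f (Finset.mem_insert_of_mem hf)) ?_
    rintro _ (rfl | h)
    · obtain ⟨b, hbB, hgb⟩ := hGB g (Finset.mem_insert_self _ _)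
      refine GCov_cut (GCov.le (Finset.empty_subset _) (GCov_of_axiom (PatchThy.Loc g b hgb))) ?_
      rintro _ (rfl | rfl)
      · refine GCov_mono (𝒰 := {{PatchGen.l ({g} ∪ G)}}) ?_ ?_
        · refine GCov.le ?_ (patchCov_l_union hb _ _)
          intro x hx
          simp only [Finset.mem_insert, Finset.mem_union, Finset.mem_singleton] at hx ⊢
          tauto
        · rw [← Finset.insert_eq]
          exact Set.subset_union_left
      · exact GCov.le Finset.subset_union_right (GCov.refl (Or.inr ⟨b, hbB, rfl⟩))
    · exact GCov.refl (Or.inr h)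

theorem epsP_isFTM :
    IsFTM (patchCov cov le) supord cov le (epsP cov le) := by
  refine ⟨?_, ?_, ?_⟩
  · rintro a U h 𝔄 ⟨_, rfl, h𝔄⟩
    refine GCov_trans h𝔄 ?_
    rintro _ rfl
    refine GCov_mono (patchCov_r h) ?_
    rintro _ ⟨b, hbU, rfl⟩
    exact ⟨b, hbU, GCov.refl rfl⟩
  · intro 𝔄 _
    refine GCov.le (Finset.empty_subset _) (GCov_mono (GCov_of_axiom PatchThy.R1) ?_)
    rintro _ ⟨a, rfl⟩
    exact ⟨a, trivial, GCov.refl rfl⟩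
  · rintro a b 𝔄 ⟨𝔅, ⟨a', ha, h𝔅⟩, ℭ, ⟨b', hb', hℭ⟩, h₁, h₂⟩
    rw [Set.mem_singleton_iff.1 ha] at h𝔅
    rw [Set.mem_singleton_iff.1 hb'] at hℭ
    have key : GCov (PatchThy cov le) 𝔄 {({PatchGen.r a, PatchGen.r b} : Finset (PatchGen S))} := by
      refine GCov_singleton_of_forall ?_
      intro g hg
      rcases Finset.mem_insert.1 hg with rfl | hg
      · exact GCov.le h₁ h𝔅
      · rw [Finset.mem_singleton.1 hg]
        exact GCov.le h₂ hℭ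
    refine GCov_trans key ?_
    rintro _ rfl
    refine GCov_mono (GCov_of_axiom (PatchThy.R2 a b)) ?_
    rintro _ ⟨c, hc, rfl⟩
    exact ⟨c, hc, GCov.refl rfl⟩

/-! ### Perfectness -/

/-- A way-below relation on the generators of the patch topology. -/
def GenWB (cov : S → Set S → Prop) : PatchGen S → PatchGen S → Prop
  | PatchGen.r a', PatchGen.r a => wb cov a' a
  | PatchGen.l A', PatchGen.l A => wbS cov ↑A ↑A'
  | _, _ => False

/-- Every generator in the second set has a generator way below it in the first set. -/
def Shrinks (cov : S → Set S → Prop) (𝔄' 𝔄 : Finset (PatchGen S)) : Prop :=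
  ∀ g ∈ 𝔄, ∃ g' ∈ 𝔄', GenWB cov g' g

theorem Shrinks.exists_r {𝔄' 𝔄 : Finset (PatchGen S)} (h : Shrinks cov 𝔄' 𝔄) {a : S}
    (ha : PatchGen.r a ∈ 𝔄) : ∃ a', PatchGen.r a' ∈ 𝔄' ∧ wb cov a' a := by
  obtain ⟨g | g, hg, hga⟩ := h _ ha
  · exact ⟨g, hg, hga⟩
  · exact hga.elim

theorem Shrinks.exists_l {𝔄' 𝔄 : Finset (PatchGen S)} (h : Shrinks cov 𝔄' 𝔄) {A : Finset S}
    (hA : PatchGen.l A ∈ 𝔄) : ∃ A', PatchGen.l A' ∈ 𝔄' ∧ wbS cov ↑A ↑A' := by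
  obtain ⟨g | g, hg, hga⟩ := h _ hA
  · exact hga.elim
  · exact ⟨g, hg, hga⟩

theorem shrinks_r {a' a : S} (h : wb cov a' a) :
    Shrinks cov {PatchGen.r a'} {PatchGen.r a} := by
  intro g hg
  rw [Finset.mem_singleton.1 hg]
  exact ⟨_, Finset.mem_singleton_self _, h⟩

theorem shrinks_l {A' A : Finset S} (h : wbS cov ↑A ↑A') :
    Shrinks cov {PatchGen.l A'} {PatchGen.l A} := by
  intro g hg
  rw [Finset.mem_singleton.1 hg]
  exact ⟨_, Finset.mem_singleton_self _, h⟩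

theorem Shrinks.union {𝔄' 𝔅' 𝔄 𝔅 : Finset (PatchGen S)} (hA : Shrinks cov 𝔄' 𝔄)
    (hB : Shrinks cov 𝔅' 𝔅) : Shrinks cov (𝔄' ∪ 𝔅') (𝔄 ∪ 𝔅) := by
  intro g hg
  rcases Finset.mem_union.1 hg with h | h
  · obtain ⟨g', h₁, h₂⟩ := hA g h
    exact ⟨g', Finset.mem_union_left _ h₁, h₂⟩
  · obtain ⟨g', h₁, h₂⟩ := hB g h
    exact ⟨g', Finset.mem_union_right _ h₁, h₂⟩

theorem Shrinks.mono_right {𝔄' 𝔄 𝔅 : Finset (PatchGen S)} (h : Shrinks cov 𝔄' 𝔄)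
    (hB : 𝔅 ⊆ 𝔄) : Shrinks cov 𝔄' 𝔅 :=
  fun g hg => h g (hB hg)

theorem Shrinks.patchCov (hb : IsBasicCover cov) {𝔄' 𝔄 : Finset (PatchGen S)}
    (h : Shrinks cov 𝔄' 𝔄) : patchCov cov le 𝔄' {𝔄} := by
  refine GCov_singleton_of_forall ?_
  rintro (a | A) hg
  · obtain ⟨a', ha', haa'⟩ := h.exists_r hg
    exact GCov.le (Finset.singleton_subset_iff.2 ha') (patchCov_r_of_cov (cov_of_wb hb haa'))
  · obtain ⟨A', hA', hAA'⟩ := h.exists_l hg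
    exact GCov.le (Finset.singleton_subset_iff.2 hA') (patchCov_l (covS_of_wbS hb hAA'))

/-- Covers of `𝔄'` by basic opens `r f`, with `f` in a finite set way below `U`. -/
theorem exists_shrinking_r {𝔄' : Finset (PatchGen S)} {a : S} {F : Finset S} {U : Set S}
    (ha : PatchGen.r a ∈ 𝔄') (hF : cov a ↑F) (hFU : ∀ f ∈ F, ∃ u ∈ U, wb cov f u) :
    ∃ ℱ : Finset (Finset (PatchGen S)),
      (∀ 𝔅' ∈ ℱ, ∃ u ∈ U, Shrinks cov 𝔅' {PatchGen.r u}) ∧ patchCov cov le 𝔄' ↑ℱ := by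
  refine ⟨F.image fun f => {PatchGen.r f}, ?_, ?_⟩
  · intro 𝔅' h
    obtain ⟨f, hf, rfl⟩ := Finset.mem_image.1 h
    obtain ⟨u, hu, hfu⟩ := hFU f hf
    exact ⟨u, hu, shrinks_r hfu⟩
  · refine GCov.le (Finset.singleton_subset_iff.2 ha) (GCov_mono (patchCov_r_finset hF) ?_)
    rintro _ ⟨b, hbF, rfl⟩
    exact Finset.mem_coe.2 (Finset.mem_image_of_mem _ hbF)

/-- Every axiom of the patch theory has a finitary version for shrinkings of its antecedent. -/
theorem exists_finite_shrinking (hft : IsFormalTopology cov le) (hw : IsContinuous cov w)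
    (hst : Stable cov le) {𝔄' 𝔄 : Finset (PatchGen S)} {𝒞 : Set (Finset (PatchGen S))}
    (hT : PatchThy cov le 𝔄 𝒞) (h : Shrinks cov 𝔄' 𝔄)
    (hbd : ∃ x x', PatchGen.r x ∈ 𝔄' ∧ wb cov x x') :
    ∃ ℱ : Finset (Finset (PatchGen S)),
      (∀ 𝔅' ∈ ℱ, ∃ 𝔅 ∈ 𝒞, Shrinks cov 𝔅' 𝔅) ∧ patchCov cov le 𝔄' ↑ℱ := by
  have hb := hft.1
  cases hT with
  | R1 =>
    obtain ⟨x, x', hx, hxx'⟩ := hbd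
    obtain ⟨F, hF, hFU⟩ := exists_finset_wb hb hw (V' := Set.univ) (wbS_singleton hxx')
      fun a _ => hb.1 a _ trivial
    obtain ⟨ℱ, h₁, h₂⟩ := exists_shrinking_r (le := le) hx (hF x rfl) hFU
    exact ⟨ℱ, fun 𝔅' h' => let ⟨u, _, hu⟩ := h₁ 𝔅' h'; ⟨_, ⟨u, rfl⟩, hu⟩, h₂⟩
  | R2 a b =>
    obtain ⟨a', ha', haa'⟩ := h.exists_r (a := a) (by simp)
    obtain ⟨b', hb', hbb'⟩ := h.exists_r (a := b) (by simp)
    obtain ⟨F, hF, hFU⟩ := exists_finset_wb hb hw (hst _ _ _ _ haa' hbb')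
      fun c hc => hb.1 c _ hc
    refine ⟨F.image fun f => {PatchGen.r f}, ?_, ?_⟩
    · intro 𝔅' h
      obtain ⟨f, hf, rfl⟩ := Finset.mem_image.1 h
      obtain ⟨u, hu, hfu⟩ := hFU f hf
      exact ⟨_, ⟨u, hu, rfl⟩, shrinks_r hfu⟩
    · refine GCov.le (B := {PatchGen.r a', PatchGen.r b'}) ?_ ?_
      · intro g hg
        rcases Finset.mem_insert.1 hg with rfl | hg
        · exact ha'
        · rwa [Finset.mem_singleton.1 hg]
      refine GCov_trans (GCov_of_axiom (PatchThy.R2 a' b')) ?_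
      rintro _ ⟨c, hc, rfl⟩
      refine GCov_mono (patchCov_r_finset (hF c hc)) ?_
      rintro _ ⟨f, hf, rfl⟩
      exact Finset.mem_coe.2 (Finset.mem_image_of_mem _ hf)
  | R3 a A hA =>
    obtain ⟨a', ha', haa'⟩ := h.exists_r (a := a) (by simp)
    obtain ⟨F, hF, hFU⟩ := exists_finset_wb hb hw (V' := ↑A) (wbS_singleton haa')
      (by rintro _ rfl; exact hA)
    obtain ⟨ℱ, h₁, h₂⟩ := exists_shrinking_r (le := le) ha' (hF a' rfl) hFU
    exact ⟨ℱ, fun 𝔅' h' => let ⟨u, huA, hu⟩ := h₁ 𝔅' h'; ⟨_, ⟨u, huA, rfl⟩, hu⟩, h₂⟩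
  | R4 a =>
    obtain ⟨a', ha', haa'⟩ := h.exists_r (a := a) (by simp)
    obtain ⟨F, hF, hFU⟩ := exists_finset_wb hb hw (V' := {b | wb cov b a})
      (wbS_singleton haa')
      (by rintro _ rfl; exact hb.mono (hw.2 _) (hw.1 _))
    obtain ⟨ℱ, h₁, h₂⟩ := exists_shrinking_r (le := le) ha' (hF a' rfl) hFU
    exact ⟨ℱ, fun 𝔅' h' => let ⟨u, hua, hu⟩ := h₁ 𝔅' h'; ⟨_, ⟨u, hua, rfl⟩, hu⟩, h₂⟩
  | L1 =>
    refine ⟨{{PatchGen.l ∅}}, ?_, ?_⟩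
    · intro 𝔅' h
      rw [Finset.mem_singleton.1 h]
      exact ⟨_, rfl, shrinks_l (wbS_of_forall_wb hb (by simp))⟩
    · refine GCov.le (Finset.empty_subset _) ?_
      rw [Finset.coe_singleton]
      exact GCov_of_axiom PatchThy.L1
  | L2 A B hAB =>
    obtain ⟨B', hB', hBB'⟩ := h.exists_l (A := B) (by simp)
    refine ⟨{{PatchGen.l B'}}, ?_, ?_⟩
    · intro 𝔅' h
      rw [Finset.mem_singleton.1 h]
      exact ⟨_, rfl, shrinks_l (wbS_of_covS_left hb hAB hBB')⟩
    · exact GCov.le (Finset.singleton_subset_iff.2 hB') (GCov.refl (by simp))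
  | L3 A B =>
    obtain ⟨A', hA', hAA'⟩ := h.exists_l (A := A) (by simp)
    obtain ⟨B', hB', hBB'⟩ := h.exists_l (A := B) (by simp)
    obtain ⟨F, hF, hFA⟩ := exists_interpolant hb hw hAA'
    obtain ⟨G, hG, hGB⟩ := exists_interpolant hb hw hBB'
    have hmono : ∀ {U V V' : Set S}, wbS cov U V → V ⊆ V' → wbS cov U V' :=
      fun h hV W hW => h W fun a ha => hW a (hV ha)
    refine ⟨{{PatchGen.l (A' ∪ B')}}, ?_, ?_⟩
    · intro 𝔅' h
      rw [Finset.mem_singleton.1 h]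
      refine ⟨_, ⟨F ∪ G, hmono hF (by simp), hmono hG (by simp), rfl⟩,
        shrinks_l (wbS_of_forall_wb hb ?_)⟩
      intro f hf
      rcases Finset.mem_union.1 hf with hf | hf
      · obtain ⟨v, hv, hfv⟩ := hFA f hf
        exact ⟨v, by simpa using Or.inl hv, hfv⟩
      · obtain ⟨v, hv, hfv⟩ := hGB f hf
        exact ⟨v, by simpa using Or.inr hv, hfv⟩
    · rw [Finset.coe_singleton]
      refine GCov.le ?_ (patchCov_l_union hb A' B')
      intro g hg
      rcases Finset.mem_insert.1 hg with rfl | hg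
      · exact hA'
      · rwa [Finset.mem_singleton.1 hg]
  | Loc a b hab =>
    obtain ⟨F, hF, hFb⟩ := exists_interpolant hb hw (wbS_singleton hab)
    obtain ⟨G, hG, hGb⟩ := exists_interpolant hb hw (wbS_of_forall_wb hb hFb)
    refine ⟨insert {PatchGen.l F} (G.image fun c => {PatchGen.r c}), ?_, ?_⟩
    · intro 𝔅' h
      rcases Finset.mem_insert.1 h with rfl | h
      · exact ⟨_, Or.inl rfl, shrinks_l (by simpa using hF)⟩
      · obtain ⟨c, hc, rfl⟩ := Finset.mem_image.1 h
        obtain ⟨_, rfl, hcb⟩ := hGb c hc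
        exact ⟨_, Or.inr rfl, shrinks_r hcb⟩
    · refine GCov.le (Finset.empty_subset _) (GCov_mono (patchCov_locatedness hb hw hG) ?_)
      rintro _ (rfl | ⟨c, hc, rfl⟩)
      · exact Finset.mem_coe.2 (Finset.mem_insert_self _ _)
      · exact Finset.mem_coe.2 (Finset.mem_insert_of_mem (Finset.mem_image_of_mem _ hc))
  | D a =>
    obtain ⟨C, hC, haC⟩ := h.exists_l (A := {a}) (by simp)
    obtain ⟨a', ha', haa'⟩ := h.exists_r (a := a) (by simp)
    refine ⟨∅, by simp, GCov.le (B := {PatchGen.l C, PatchGen.r a'}) ?_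
      (patchCov_l_disjoint_r ?_ _)⟩
    · intro g hg
      rcases Finset.mem_insert.1 hg with rfl | hg
      · exact hC
      · rwa [Finset.mem_singleton.1 hg]
    · refine hb.2 _ _ _ (cov_of_wb hb haa') ?_
      rintro _ rfl
      exact covS_of_wbS hb haC _ (by simp)

theorem exists_finite_subcover (hft : IsFormalTopology cov le) (hw : IsContinuous cov w)
    (hst : Stable cov le) {𝔄 : Finset (PatchGen S)} {𝒰 : Set (Finset (PatchGen S))}
    (h : patchCov cov le 𝔄 𝒰) {𝔄' : Finset (PatchGen S)} (hs : Shrinks cov 𝔄' 𝔄)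
    (hbd : ∃ x x', PatchGen.r x ∈ 𝔄' ∧ wb cov x x') :
    ∃ 𝒰₀ : Finset (Finset (PatchGen S)), ↑𝒰₀ ⊆ 𝒰 ∧ patchCov cov le 𝔄' ↑𝒰₀ := by
  unfold patchCov at h
  induction h generalizing 𝔄' with
  | @refl A _ hA => exact ⟨{A}, by simpa using hA, by simpa using hs.patchCov hft.1⟩
  | le hBA _ ih => exact ih (hs.mono_right hBA) hbd
  | @ax A _ 𝒰 C hT _ ih =>
    obtain ⟨ℱ, hℱ, hcov⟩ := exists_finite_shrinking hft hw hst hT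
      (hs.mono_right Finset.subset_union_right) hbd
    have key : ∀ 𝔅' ∈ ℱ, ∃ 𝒰₀ : Finset (Finset (PatchGen S)), ↑𝒰₀ ⊆ 𝒰 ∧
        FTP.patchCov cov le (𝔄' ∪ 𝔅') ↑𝒰₀ := by
      intro 𝔅' h'
      obtain ⟨B, hB, hs'⟩ := hℱ 𝔅' h'
      obtain ⟨x, x', hx, hxx'⟩ := hbd
      exact ih B hB ((hs.mono_right Finset.subset_union_left).union hs')
        ⟨x, x', Finset.mem_union_left _ hx, hxx'⟩
    choose! f hf hcovf using key
    refine ⟨ℱ.biUnion f, ?_, GCov_cut hcov fun 𝔅' h' => GCov_mono (hcovf 𝔅' h') ?_⟩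
    · intro x hx
      obtain ⟨B, hB, hx⟩ := Finset.mem_biUnion.1 (Finset.mem_coe.1 hx)
      exact hf B hB hx
    · exact Finset.coe_subset.2 (Finset.subset_biUnion_of_mem f (Finset.mem_coe.1 h'))

theorem epsP_isPerfect (hft : IsFormalTopology cov le) (hw : IsContinuous cov w)
    (hst : Stable cov le) : IsPerfect (patchCov cov le) cov (epsP cov le) := by
  intro a b hab W hW
  obtain ⟨W₀, h₀, hcov⟩ := exists_finite_subcover hft hw hst
    (hW {PatchGen.r b} ⟨b, rfl, GCov.refl rfl⟩) (shrinks_r hab)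
    ⟨a, b, Finset.mem_singleton_self _, hab⟩
  refine ⟨W₀, h₀, ?_⟩
  rintro 𝔄 ⟨_, rfl, h𝔄⟩
  refine GCov_trans h𝔄 ?_
  rintro _ rfl
  exact hcov

end Patch

/-! ### Maps into a presented topology -/

section Maps

variable {Q : Type*} {cov'' : Q → Set Q → Prop} {le'' : Q → Q → Prop}
  {P : Type*} {T : Finset P → Set (Finset P) → Prop} {t : Q → Finset P → Prop}

theorem IsFTM.cov_trans (hQ : IsBasicCover cov'') {leP : Finset P → Finset P → Prop}
    (ht : IsFTM cov'' le'' (GCov T) leP t) {x : Q}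
    {𝒰 𝒱 : Set (Finset P)} (h : cov'' x (rinv t 𝒰)) (h' : ∀ A ∈ 𝒰, GCov T A 𝒱) :
    cov'' x (rinv t 𝒱) := by
  refine hQ.2 _ _ _ h ?_
  rintro y ⟨A, hA, hy⟩
  exact ht.1 A 𝒱 (h' A hA) y ⟨A, rfl, hy⟩

theorem IsFTM.cov_empty (hQ : IsBasicCover cov'')
    (ht : IsFTM cov'' le'' (GCov T) supord t) (x : Q) : cov'' x (rinv t {(∅ : Finset P)}) :=
  ht.cov_trans hQ (ht.2.1 x trivial) fun _ _ =>
    GCov.le (Finset.empty_subset _) (GCov.refl rfl)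

theorem IsFTM.cov_union (hQ : IsFormalTopology cov'' le'')
    (ht : IsFTM cov'' le'' (GCov T) supord t) {x : Q} {A B : Finset P}
    (hA : cov'' x (rinv t {A})) (hB : cov'' x (rinv t {B})) : cov'' x (rinv t {A ∪ B}) := by
  refine ht.cov_trans hQ.1 (hQ.1.2 _ _ _ (hQ.2.2.2.2 x _ _ hA hB) (ht.2.2 A B)) ?_
  rintro D ⟨_, rfl, _, rfl, h₁, h₂⟩
  exact GCov.le (Finset.union_subset h₁ h₂) (GCov.refl rfl)

theorem IsFTM.cov_of_forall (hQ : IsFormalTopology cov'' le'')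
    (ht : IsFTM cov'' le'' (GCov T) supord t) {x : Q} {A : Finset P}
    (h : ∀ g ∈ A, cov'' x (rinv t {({g} : Finset P)})) : cov'' x (rinv t {A}) := by
  induction A using Finset.induction_on with
  | empty => exact ht.cov_empty hQ.1 x
  | insert g A _ ih =>
    rw [Finset.insert_eq]
    exact ht.cov_union hQ (h g (Finset.mem_insert_self _ _))
      (ih fun g' h' => h g' (Finset.mem_insert_of_mem h'))

end Maps

section Mono

variable {S : Type*} {cov : S → Set S → Prop} {le : S → S → Prop} {w : S → Set S}
  {Q : Type*} {cov'' : Q → Set Q → Prop} {le'' : Q → Q → Prop}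
  {t u : Q → Finset (PatchGen S) → Prop}

theorem cov_r_of_mapLE (hQ : IsBasicCover cov'') (hu : IsFTM cov'' le'' (patchCov cov le) supord u)
    (h : MapLE cov'' (comp (epsP cov le) t) (comp (epsP cov le) u)) {x : Q} {a : S}
    (hx : cov'' x (rinv t {({PatchGen.r a} : Finset (PatchGen S))})) :
    cov'' x (rinv u {({PatchGen.r a} : Finset (PatchGen S))}) := by
  refine hQ.2 _ _ _ hx ?_
  rintro y ⟨_, rfl, hy⟩
  refine hQ.2 _ _ _ (h a y ⟨a, rfl, _, hy, GCov.refl rfl⟩) ?_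
  rintro z ⟨_, rfl, 𝔅, hz, h𝔅⟩
  exact hu.1 𝔅 _ h𝔅 z ⟨𝔅, rfl, hz⟩

theorem cov_l_of_mapLE (hb : IsBasicCover cov) (hw : IsContinuous cov w)
    (hQ : IsFormalTopology cov'' le'')
    (ht : IsFTM cov'' le'' (patchCov cov le) supord t)
    (hu : IsFTM cov'' le'' (patchCov cov le) supord u)
    (h : MapLE cov'' (comp (epsP cov le) u) (comp (epsP cov le) t)) {x : Q} {A : Finset S}
    (hx : cov'' x (rinv t {({PatchGen.l A} : Finset (PatchGen S))})) :
    cov'' x (rinv u {({PatchGen.l A} : Finset (PatchGen S))}) := by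
  have hx' := ht.cov_trans hQ.1 (𝒱 := {D | ∃ C : Finset S, wbS cov ↑A ↑C ∧ D = {PatchGen.l C}}) hx
    (by
      rintro _ rfl
      have := GCov_of_axiom (PatchThy.L3 (cov := cov) (le := le) A A)
      rw [Finset.pair_eq_singleton] at this
      refine GCov_mono this ?_
      rintro _ ⟨C, hC, _, rfl⟩
      exact ⟨C, hC, rfl⟩)
  refine hQ.1.2 _ _ _ hx' ?_
  rintro y ⟨_, ⟨C, hAC, rfl⟩, hy⟩
  have hloc := hu.cov_trans hQ.1 (hu.cov_empty hQ.1 y)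
    (by rintro _ rfl; exact patchCov_locatedness hb hw hAC)
  refine hQ.1.2 _ _ _ (hQ.2.2.2.2 y _ _ (hQ.1.1 y {y} rfl) hloc) ?_
  rintro z ⟨_, rfl, z', ⟨D, hD, hz'⟩, hzy, hzz'⟩
  have hzu : cov'' z (rinv u {D}) := by
    refine hQ.1.2 _ _ _ (hQ.2.2.2.1 z z' hzz') ?_
    rintro _ rfl
    exact hQ.1.1 _ _ ⟨D, rfl, hz'⟩
  rcases hD with rfl | ⟨c, hc, rfl⟩
  · exact hzu
  · have hzt : cov'' z (rinv t {({PatchGen.l C} : Finset (PatchGen S))}) := by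
      refine hQ.1.2 _ _ _ (hQ.2.2.2.1 z _ hzy) ?_
      rintro _ rfl
      exact hQ.1.1 _ _ ⟨_, rfl, hy⟩
    have hz := ht.cov_trans hQ.1 (𝒱 := ∅)
      (ht.cov_union hQ hzt (cov_r_of_mapLE hQ.1 ht h hzu)) (by
        rintro _ rfl
        exact patchCov_l_disjoint_r (hb.1 c _ hc) _)
    refine hQ.1.2 _ _ _ hz ?_
    rintro _ ⟨_, h', _⟩
    exact h'.elim

theorem mapLE_of_comp_epsP (hb : IsBasicCover cov) (hw : IsContinuous cov w)
    (hQ : IsFormalTopology cov'' le'')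
    (ht : IsFTM cov'' le'' (patchCov cov le) supord t)
    (hu : IsFTM cov'' le'' (patchCov cov le) supord u)
    (h : MapEq cov'' (comp (epsP cov le) t) (comp (epsP cov le) u)) : MapLE cov'' t u := by
  rintro 𝔄 x ⟨_, rfl, hx⟩
  refine hu.cov_of_forall hQ fun g hg => ?_
  have hxg := ht.cov_trans hQ.1 (𝒱 := {{g}}) (hQ.1.1 x _ ⟨_, rfl, hx⟩) (by
    rintro _ rfl
    exact GCov.le (Finset.singleton_subset_iff.2 hg) (GCov.refl rfl))
  cases g with
  | r a => exact cov_r_of_mapLE hQ.1 hu h.1 hxg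
  | l A => exact cov_l_of_mapLE hb hw hQ ht hu h.2 hxg

end Mono

/-- For a stably locally compact formal topology `S`, the map
`ε_P : Patch(S) → S` is a perfect formal topology map, and it is a monomorphism
in the category of formal topologies. -/
theorem epsP_perfect_and_mono {S : Type u}
    (cov : S → Set S → Prop) (le : S → S → Prop)
    (hft : IsFormalTopology cov le) (w : S → Set S) (hw : IsContinuous cov w)
    (hst : Stable cov le) :
    IsFTM (patchCov cov le) supord cov le (epsP cov le) ∧
    IsPerfect (patchCov cov le) cov (epsP cov le) ∧
    (∀ (S'' : Type u) (cov'' : S'' → Set S'' → Prop) (le'' : S'' → S'' → Prop),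
      IsFormalTopology cov'' le'' →
      ∀ t u : S'' → Finset (PatchGen S) → Prop,
        IsFTM cov'' le'' (patchCov cov le) supord t →
        IsFTM cov'' le'' (patchCov cov le) supord u →
        MapEq cov'' (comp (epsP cov le) t) (comp (epsP cov le) u) →
        MapEq cov'' t u) := by
  refine ⟨epsP_isFTM, epsP_isPerfect hft hw hst, ?_⟩
  intro S'' cov'' le'' hQ t u ht hu h
  exact ⟨mapLE_of_comp_epsP hft.1 hw hQ ht hu h, mapLE_of_comp_epsP hft.1 hw hQ hu ht ⟨h.2, h.1⟩⟩

end FTP
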